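/- (Proposition 2.1, strong convexity inequality for p ≥ 2) For every p ≥ 2 there exists a constant Ĉ_p > 0 such that for all η, η' ∈ ℝ^N one has H(η)^p ≥ H(η')^p + p a_p(η') · (η − η') + Ĉ_p H(η − η')^p. -/

import Mathlib

section helpers

theorem aux_taylor (φ φ' φ'' : ℝ → ℝ) (m : ℝ)
    (h1 : ∀ s ∈ Set.Icc (0:ℝ) 1, HasDerivAt φ (φ' s) s)
    (h2 : ∀ s ∈ Set.Icc (0:ℝ) 1, HasDerivAt φ' (φ'' s) s)
    (h3 : ∀ s ∈ Set.Icc (0:ℝ) 1, 2 * m ≤ φ'' s) :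
    φ 0 + φ' 0 + m ≤ φ 1 := by
  have d1 : ∀ s ∈ Set.Icc (0:ℝ) 1, HasDerivAt (fun s => φ' s - 2 * m * s) (φ'' s - 2 * m) s := by
    intro s hs
    exact ((h2 s hs).sub ((hasDerivAt_id s).const_mul (2*m))).congr_deriv (by simp)
  have m1 : MonotoneOn (fun s => φ' s - 2 * m * s) (Set.Icc (0:ℝ) 1) := by
    apply monotoneOn_of_hasDerivWithinAt_nonneg (convex_Icc 0 1)
      (fun s hs => (d1 s hs).continuousAt.continuousWithinAt)
      (fun s hs => (d1 s (interior_subset hs)).hasDerivWithinAt)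
    intro s hs
    linarith [h3 s (interior_subset hs)]
  have d2 : ∀ s ∈ Set.Icc (0:ℝ) 1, HasDerivAt (fun s => φ s - φ' 0 * s - m * s ^ 2)
      (φ' s - φ' 0 - 2 * m * s) s := by
    intro s hs
    have := ((h1 s hs).sub ((hasDerivAt_id s).const_mul (φ' 0))).sub
      (((hasDerivAt_id s).pow 2).const_mul m)
    refine HasDerivAt.congr_deriv this ?_
    simp; ring
  have m2 : MonotoneOn (fun s => φ s - φ' 0 * s - m * s ^ 2) (Set.Icc (0:ℝ) 1) := by
    apply monotoneOn_of_hasDerivWithinAt_nonneg (convex_Icc 0 1)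
      (fun s hs => (d2 s hs).continuousAt.continuousWithinAt)
      (fun s hs => (d2 s (interior_subset hs)).hasDerivWithinAt)
    intro s hs
    have hs' := interior_subset hs
    have := m1 (Set.left_mem_Icc.2 zero_le_one) hs' hs'.1
    simp at this
    linarith
  have := m2 (Set.left_mem_Icc.2 zero_le_one) (Set.right_mem_Icc.2 zero_le_one) zero_le_one
  simp at this
  linarith

/-- The scalar part: from the case `p = 2` to general `p`. -/
theorem aux_scalar (p c : ℝ) (hp : 2 ≤ p) (hc : 0 < c) :
    ∃ C : ℝ, 0 < C ∧ C ≤ 1 ∧ ∀ h k d g : ℝ, 0 ≤ h → 0 < k → 0 ≤ d → d ≤ h + k → g ≤ h →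
      c * d ^ 2 ≤ h ^ 2 + k ^ 2 - 2 * k * g →
      k ^ p + p * (k ^ (p - 1) * (g - k)) + C * d ^ p ≤ h ^ p := by
  have hM : (0:ℝ) < 2 * p + 1 := by linarith
  have hMp : 0 < (2 * p + 1) ^ (p - 2) := Real.rpow_pos_of_pos hM _
  have h2p : (0:ℝ) < 2 ^ p := Real.rpow_pos_of_pos two_pos _
  have h2p1 : (1:ℝ) ≤ 2 ^ p := Real.one_le_rpow (by norm_num) (by linarith)
  refine ⟨min (p / 2 * c / (2 * p + 1) ^ (p - 2)) (1 / (2 * 2 ^ p)), by positivity, ?_, ?_⟩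
  · refine (min_le_right _ _).trans ?_
    rw [div_le_one (by positivity)]; linarith
  intro h k d g hh hk hd hdk hgh hq
  have split : ∀ x : ℝ, 0 ≤ x → x ^ p = x ^ (p - 2) * x ^ 2 := by
    intro x hx
    rw [← Real.rpow_natCast x 2, ← Real.rpow_add' hx (by norm_num; linarith)]
    norm_num
  have k1 : k ^ (p - 1) = k ^ (p - 2) * k := by
    rw [← Real.rpow_add_one hk.ne']; ring_nf
  have hkp : 0 < k ^ (p - 2) := Real.rpow_pos_of_pos hk _
  have hdp : 0 ≤ d ^ p := Real.rpow_nonneg hd _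
  rcases le_or_gt d ((2 * p + 1) * k) with hcase | hcase
  · -- Bernoulli
    have bern : k ^ p + p / 2 * (k ^ (p - 2) * (h ^ 2 - k ^ 2)) ≤ h ^ p := by
      have b := one_add_mul_self_le_rpow_one_add (s := h ^ 2 / k ^ 2 - 1)
        (by have : 0 ≤ h ^ 2 / k ^ 2 := by positivity
            linarith) (p := p / 2) (by linarith)
      have e : (1 + (h ^ 2 / k ^ 2 - 1)) ^ (p / 2) = h ^ p / k ^ p := by
        rw [add_sub_cancel, ← div_pow, ← Real.rpow_natCast, ← Real.rpow_mul (by positivity),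
          Real.div_rpow hh hk.le]
        norm_num
        rw [mul_div_cancel₀ _ (by norm_num)]
      rw [e, le_div_iff₀ (Real.rpow_pos_of_pos hk _)] at b
      refine le_trans (le_of_eq ?_) b
      rw [split k hk.le]
      field_simp
    have : min (p / 2 * c / (2 * p + 1) ^ (p - 2)) (1 / (2 * 2 ^ p)) * d ^ p
        ≤ p / 2 * c * (k ^ (p - 2) * d ^ 2) := by
      calc _ ≤ (p / 2 * c / (2 * p + 1) ^ (p - 2)) * d ^ p := by
            gcongr; exact min_le_left _ _
        _ ≤ (p / 2 * c / (2 * p + 1) ^ (p - 2)) * (((2 * p + 1) * k) ^ (p - 2) * d ^ 2) := by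
            rw [split d hd]
            have : 0 ≤ p - 2 := by linarith
            gcongr
        _ = _ := by
            rw [Real.mul_rpow hM.le hk.le]; field_simp
    have q2 := mul_le_mul_of_nonneg_left hq (by positivity : 0 ≤ p / 2 * k ^ (p - 2))
    rw [k1]
    nlinarith
  · have hpk : 2 * p * k ≤ h := by nlinarith
    have hd2 : d ≤ 2 * h := by nlinarith
    have : min (p / 2 * c / (2 * p + 1) ^ (p - 2)) (1 / (2 * 2 ^ p)) * d ^ p ≤ h ^ p / 2 := by
      calc _ ≤ (1 / (2 * 2 ^ p)) * d ^ p := by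
            gcongr; exact min_le_right _ _
        _ ≤ (1 / (2 * 2 ^ p)) * (2 * h) ^ p := by gcongr
        _ = _ := by rw [Real.mul_rpow two_pos.le hh]; field_simp
    have hkh : k ≤ h := by nlinarith
    have e1 : k ^ (p - 2) ≤ h ^ (p - 2) := Real.rpow_le_rpow hk.le hkh (by linarith)
    have e2 : p * (k ^ (p - 1) * g) ≤ h ^ p / 2 := by
      rw [k1, split h hh]
      calc p * (k ^ (p - 2) * k * g) ≤ p * (k ^ (p - 2) * k * h) := by gcongr
        _ = k ^ (p - 2) * ((2 * p * k) * h) / 2 := by ring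
        _ ≤ h ^ (p - 2) * (h * h) / 2 := by gcongr
        _ = _ := by ring
    have e3 : k ^ p ≤ p * (k ^ (p - 1) * k) := by
      rw [k1, split k hk.le]
      have : 0 ≤ k ^ (p - 2) * k ^ 2 := by positivity
      nlinarith
    nlinarith

set_option maxHeartbeats 1000000 in
/-- The case `p = 2`. -/
theorem aux_quad {N : ℕ} (hN : 2 ≤ N)
    (H : EuclideanSpace ℝ (Fin N) → ℝ)
    (hH0 : H 0 = 0)
    (hHC2 : ContDiffOn ℝ 2 H {(0 : EuclideanSpace ℝ (Fin N))}ᶜ)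
    (hHeven : ∀ ξ : EuclideanSpace ℝ (Fin N), H (-ξ) = H ξ)
    (hHpos : ∀ ξ : EuclideanSpace ℝ (Fin N), ξ ≠ 0 → 0 < H ξ)
    (hhom : ∀ ξ : EuclideanSpace ℝ (Fin N), ∀ t : ℝ, 0 ≤ t → H (t • ξ) = t * H ξ)
    (hHell : ∃ lam : ℝ, 0 < lam ∧ ∀ ξ : EuclideanSpace ℝ (Fin N), H ξ = 1 →
      ∀ ζ : EuclideanSpace ℝ (Fin N), fderiv ℝ H ξ ζ = 0 →
        lam * ‖ζ‖ ^ 2 ≤ fderiv ℝ (fderiv ℝ H) ξ ζ ζ) 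
    (hC : ∀ x : EuclideanSpace ℝ (Fin N), x ≠ 0 → ContDiffAt ℝ 2 H x)
    (hD1 : ∀ x : EuclideanSpace ℝ (Fin N), x ≠ 0 → HasFDerivAt H (fderiv ℝ H x) x)
    (heul : ∀ x : EuclideanSpace ℝ (Fin N), x ≠ 0 → fderiv ℝ H x x = H x) :
    ∃ c : ℝ, 0 < c ∧ ∀ x y : EuclideanSpace ℝ (Fin N), x ≠ 0 →
      c * H (y - x) ^ 2 ≤ H y ^ 2 + H x ^ 2 - 2 * H x * fderiv ℝ H x y := by
  obtain ⟨lam, hlam, hell⟩ := hHell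
  have hD2 : ∀ x : EuclideanSpace ℝ (Fin N), x ≠ 0 →
      HasFDerivAt (fderiv ℝ H) (fderiv ℝ (fderiv ℝ H) x) x := by
    intro x hx
    exact (((hC x hx).fderiv_right (m := 1) (by norm_num)).differentiableAt (by norm_num)).hasFDerivAt
  -- homogeneity of derivatives
  have hG : ∀ x : EuclideanSpace ℝ (Fin N), x ≠ 0 → ∀ t : ℝ, 0 < t →
      fderiv ℝ H (t • x) = fderiv ℝ H x := by
    intro x hx t ht
    have a : HasFDerivAt (fun y => H (t • y)) (t • fderiv ℝ H (t • x)) x := by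
      have := (hD1 (t • x) (smul_ne_zero ht.ne' hx)).comp x ((hasFDerivAt_id x).const_smul t)
      refine HasFDerivAt.congr_fderiv this ?_
      ext v; simp
    have b : HasFDerivAt (fun y => H (t • y)) (t • fderiv ℝ H x) x := by
      have := (hD1 x hx).const_smul t
      refine this.congr_of_eventuallyEq (Filter.Eventually.of_forall fun y => ?_)
      simp [hhom y t ht.le]
    have := a.unique b
    exact smul_right_injective _ ht.ne' this
  have hG2 : ∀ x : EuclideanSpace ℝ (Fin N), x ≠ 0 → ∀ t : ℝ, 0 < t →
      t • fderiv ℝ (fderiv ℝ H) (t • x) = fderiv ℝ (fderiv ℝ H) x := by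
    intro x hx t ht
    have a : HasFDerivAt (fun y => fderiv ℝ H (t • y)) (t • fderiv ℝ (fderiv ℝ H) (t • x)) x := by
      have := (hD2 (t • x) (smul_ne_zero ht.ne' hx)).comp x ((hasFDerivAt_id x).const_smul t)
      refine HasFDerivAt.congr_fderiv this ?_
      ext v; simp
    have b : HasFDerivAt (fun y => fderiv ℝ H (t • y)) (fderiv ℝ (fderiv ℝ H) x) x := by
      refine (hD2 x hx).congr_of_eventuallyEq ?_
      filter_upwards [isOpen_ne.mem_nhds hx] with y hy using hG y hy t ht
    exact a.unique b
  have hz1 : ∀ x : EuclideanSpace ℝ (Fin N), x ≠ 0 → ∀ v, fderiv ℝ (fderiv ℝ H) x v x = 0 := by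
    intro x hx v
    have a := (hD2 x hx).clm_apply (hasFDerivAt_id x)
    have b : HasFDerivAt (fun y => fderiv ℝ H y (id y)) (fderiv ℝ H x) x := by
      refine (hD1 x hx).congr_of_eventuallyEq ?_
      filter_upwards [isOpen_ne.mem_nhds hx] with y hy using heul y hy
    have := congrArg (fun L => L v) (a.unique b)
    simpa using this
  have hz2 : ∀ x : EuclideanSpace ℝ (Fin N), x ≠ 0 → ∀ v, fderiv ℝ (fderiv ℝ H) x x v = 0 := by
    intro x hx v
    have := (hC x hx).isSymmSndFDerivAt (by simp) x v
    rw [this, hz1 x hx]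
  -- norm comparison
  have hcont : ContinuousOn H (Metric.sphere (0:EuclideanSpace ℝ (Fin N)) 1) := by
    refine hHC2.continuousOn.mono ?_
    intro x hx
    simp only [Set.mem_compl_iff, Set.mem_singleton_iff]
    rintro rfl
    simp at hx
  have hne : (Metric.sphere (0:EuclideanSpace ℝ (Fin N)) 1).Nonempty := by
    haveI : Nonempty (Fin N) := ⟨⟨0, by omega⟩⟩
    exact NormedSpace.sphere_nonempty.2 zero_le_one
  have hs0 : ∀ x ∈ Metric.sphere (0:EuclideanSpace ℝ (Fin N)) 1, x ≠ 0 := by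
    rintro x hx rfl
    simp at hx
  obtain ⟨x0, hx0, hmin⟩ := (isCompact_sphere _ _).exists_isMinOn hne hcont
  obtain ⟨x1, hx1, hmax⟩ := (isCompact_sphere _ _).exists_isMaxOn hne hcont
  have hr : 0 < H x0 := hHpos _ (hs0 _ hx0)
  have hR : 0 < H x1 := hHpos _ (hs0 _ hx1)
  set r := H x0
  set R := H x1
  have hbd : ∀ x, r * ‖x‖ ≤ H x ∧ H x ≤ R * ‖x‖ := by
    intro x
    by_cases hx : x = 0
    · simp [hx, hH0]
    have hn : 0 < ‖x‖ := norm_pos_iff.2 hx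
    have hm : ‖x‖⁻¹ • x ∈ Metric.sphere (0:EuclideanSpace ℝ (Fin N)) 1 := by
      simp [norm_smul, hn.ne']
    have e : H x = ‖x‖ * H (‖x‖⁻¹ • x) := by
      rw [← hhom _ _ hn.le, smul_smul, mul_inv_cancel₀ hn.ne', one_smul]
    rw [e]
    have := hmin hm
    have := hmax hm
    simp only [Set.mem_setOf_eq] at *
    constructor <;> nlinarith
  -- ellipticity
  obtain ⟨m, hm, hQ1⟩ : ∃ m : ℝ, 0 < m ∧ ∀ x v : EuclideanSpace ℝ (Fin N), H x = 1 →
      m * ‖v‖ ^ 2 ≤ (fderiv ℝ H x v) ^ 2 + fderiv ℝ (fderiv ℝ H) x v v := by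
    refine ⟨min (r ^ 2 / 2) (lam / 2), by positivity, ?_⟩
    intro x v hx
    have hx0 : x ≠ 0 := by rintro rfl; rw [hH0] at hx; norm_num at hx
    set α := fderiv ℝ H x v with hα
    set ζ := v - α • x with hζ
    have hv : v = α • x + ζ := by rw [hζ]; abel
    have hζ0 : fderiv ℝ H x ζ = 0 := by
      rw [hζ, map_sub, map_smul, heul x hx0, hx, ← hα]; simp
    have e : fderiv ℝ (fderiv ℝ H) x v v = fderiv ℝ (fderiv ℝ H) x ζ ζ := by
      rw [hv]
      simp [hz1 x hx0, hz2 x hx0]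
    have l := hell x hx ζ hζ0
    rw [e]
    have n1 : ‖v‖ ≤ |α| * ‖x‖ + ‖ζ‖ := by
      calc ‖v‖ = ‖α • x + ζ‖ := by rw [← hv]
        _ ≤ _ := by
          refine (norm_add_le _ _).trans ?_
          rw [norm_smul, Real.norm_eq_abs]
    have n2 : r * ‖x‖ ≤ 1 := hx ▸ (hbd x).1
    have n3 : ‖v‖ ^ 2 ≤ 2 * (|α| * ‖x‖) ^ 2 + 2 * ‖ζ‖ ^ 2 := by
      have := pow_le_pow_left₀ (norm_nonneg v) n1 2
      nlinarith [sq_nonneg (|α| * ‖x‖ - ‖ζ‖)]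
    set μ := min (r ^ 2 / 2) (lam / 2)
    have hμ : 0 < μ := by positivity
    have f1 : μ * (2 * (|α| * ‖x‖) ^ 2) ≤ α ^ 2 := by
      calc μ * (2 * (|α| * ‖x‖) ^ 2) ≤ (r ^ 2 / 2) * (2 * (|α| * ‖x‖) ^ 2) := by
            gcongr; exact min_le_left _ _
        _ = α ^ 2 * (r * ‖x‖) ^ 2 := by rw [mul_pow, sq_abs]; ring
        _ ≤ α ^ 2 * 1 ^ 2 := by gcongr
        _ = _ := by ring
    have f2 : μ * (2 * ‖ζ‖ ^ 2) ≤ lam * ‖ζ‖ ^ 2 := by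
      calc μ * (2 * ‖ζ‖ ^ 2) ≤ (lam / 2) * (2 * ‖ζ‖ ^ 2) := by
            gcongr; exact min_le_right _ _
        _ = _ := by ring
    nlinarith
  have hQ : ∀ x v : EuclideanSpace ℝ (Fin N), x ≠ 0 →
      m * ‖v‖ ^ 2 ≤ (fderiv ℝ H x v) ^ 2 + H x * fderiv ℝ (fderiv ℝ H) x v v := by
    intro x v hx
    have hp := hHpos x hx
    have hx' : (H x)⁻¹ • x ≠ 0 := smul_ne_zero (inv_pos.2 hp).ne' hx
    have h1 : H ((H x)⁻¹ • x) = 1 := by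
      rw [hhom _ _ (inv_pos.2 hp).le, inv_mul_cancel₀ hp.ne']
    have := hQ1 _ v h1
    rw [hG x hx _ (inv_pos.2 hp)] at this
    rw [← hG2 x hx _ (inv_pos.2 hp)]
    simp only [ContinuousLinearMap.smul_apply, smul_eq_mul]
    rwa [mul_inv_cancel_left₀ hp.ne']
  refine ⟨min 1 (m / R ^ 2), by positivity, ?_⟩
  intro x y hx
  by_cases hseg : ∃ s ∈ Set.Icc (0:ℝ) 1, x + s • (y - x) = 0
  · obtain ⟨s, hs, he⟩ := hseg
    have hs0 : s ≠ 0 := by rintro rfl; simp at he; exact hx he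
    have hsp : 0 < s := lt_of_le_of_ne hs.1 hs0.symm
    obtain ⟨t, ht, rfl⟩ : ∃ t : ℝ, 0 ≤ t ∧ y = -(t • x) := by
      refine ⟨(1 - s) / s, div_nonneg (by linarith [hs.2]) hs.1, ?_⟩
      have : s • y = -((1 - s) • x) := by
        rw [sub_smul, one_smul]
        rw [smul_sub] at he
        have : s • y = s • x - x := by
          rw [← sub_eq_zero, ← he]; abel
        rw [this]; abel
      apply smul_right_injective _ hs0
      simp only
      rw [this, smul_neg, smul_smul, mul_div_cancel₀ _ hs0]
    have e1 : H (-(t • x) - x) = (1 + t) * H x := by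
      rw [← hhom _ _ (by linarith), ← hHeven]
      congr 1
      rw [add_smul, one_smul]; abel
    rw [e1, hHeven, hhom _ _ ht, map_neg, map_smul, heul x hx, smul_eq_mul]
    have : min 1 (m / R ^ 2) * ((1 + t) * H x) ^ 2 ≤ 1 * ((1 + t) * H x) ^ 2 := by
      gcongr; exact min_le_left _ _
    nlinarith
  · push Not at hseg
    set v := y - x with hv
    have hγ : ∀ s : ℝ, HasDerivAt (fun s : ℝ => x + s • v) v s := by
      intro s
      simpa using ((hasDerivAt_id s).smul_const v).const_add x
    have T := aux_taylor (fun s => H (x + s • v) ^ 2)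
      (fun s => 2 * (H (x + s • v) * fderiv ℝ H (x + s • v) v))
      (fun s => 2 * ((fderiv ℝ H (x + s • v) v) ^ 2
        + H (x + s • v) * fderiv ℝ (fderiv ℝ H) (x + s • v) v v)) (m * ‖v‖ ^ 2) ?_ ?_ ?_
    · simp only [zero_smul, add_zero, one_smul] at T
      have e : x + v = y := by rw [hv]; abel
      rw [e] at T
      have e2 : fderiv ℝ H x v = fderiv ℝ H x y - H x := by rw [hv, map_sub, heul x hx]
      rw [e2] at T
      have hHv : 0 ≤ H v := (mul_nonneg hr.le (norm_nonneg _)).trans (hbd v).1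
      have : min 1 (m / R ^ 2) * H v ^ 2 ≤ m * ‖v‖ ^ 2 := by
        calc _ ≤ (m / R ^ 2) * (R * ‖v‖) ^ 2 := by
              gcongr
              · exact min_le_right _ _
              · exact (hbd v).2
          _ = _ := by field_simp
      nlinarith
    · intro s hs
      have a := (hD1 _ (hseg s hs)).comp_hasDerivAt s (hγ s)
      have := a.pow 2
      refine HasDerivAt.congr_deriv this ?_
      simp; ring
    · intro s hs
      have a := (hD1 _ (hseg s hs)).comp_hasDerivAt s (hγ s)
      have b := ((hD2 _ (hseg s hs)).comp_hasDerivAt s (hγ s)).clm_apply (hasDerivAt_const s v)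
      have := (a.mul b).const_mul 2
      refine HasDerivAt.congr_deriv this ?_
      simp; ring
    · intro s hs
      have := hQ _ v (hseg s hs)
      linarith

end helpers


open scoped RealInnerProductSpace Classical

/-- The anisotropic vector field `a_p(η) = H(η)^(p-1) ∇H(η)` (and `a_p 0 = 0`). -/
noncomputable def aVec {N : ℕ} (H : EuclideanSpace ℝ (Fin N) → ℝ) (p : ℝ) :
    EuclideanSpace ℝ (Fin N) → EuclideanSpace ℝ (Fin N) :=
  fun η => if η = 0 then 0 else (H η) ^ (p - 1) • gradient H η

theorem statement_7 {N : ℕ} (hN : 2 ≤ N)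
    (H : EuclideanSpace ℝ (Fin N) → ℝ)
    (hH0 : H 0 = 0)
    (hHnonneg : ∀ ξ : EuclideanSpace ℝ (Fin N), 0 ≤ H ξ)
    (hHC2 : ContDiffOn ℝ 2 H {(0 : EuclideanSpace ℝ (Fin N))}ᶜ)
    (hHeven : ∀ ξ : EuclideanSpace ℝ (Fin N), H (-ξ) = H ξ)
    (hHpos : ∀ ξ : EuclideanSpace ℝ (Fin N), ξ ≠ 0 → 0 < H ξ)
    (hHhom : ∀ ξ : EuclideanSpace ℝ (Fin N), ξ ≠ 0 → ∀ t : ℝ, 0 < t → H (t • ξ) = t * H ξ)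
    (hHell : ∃ lam : ℝ, 0 < lam ∧ ∀ ξ : EuclideanSpace ℝ (Fin N), H ξ = 1 →
      ∀ ζ : EuclideanSpace ℝ (Fin N), ⟪gradient H ξ, ζ⟫ = 0 →
        lam * ‖ζ‖ ^ 2 ≤ iteratedFDeriv ℝ 2 H ξ ![ζ, ζ])
    (p : ℝ) (hp : 2 ≤ p) :
    ∃ C : ℝ, 0 < C ∧ ∀ η η' : EuclideanSpace ℝ (Fin N),
      (H η') ^ p + p * ⟪aVec H p η', η - η'⟫ + C * (H (η - η')) ^ p ≤ (H η) ^ p := by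

  have hhom : ∀ ξ : EuclideanSpace ℝ (Fin N), ∀ t : ℝ, 0 ≤ t → H (t • ξ) = t * H ξ := by
    intro ξ t ht
    by_cases hξ : ξ = 0
    · simp [hξ, hH0]
    rcases ht.eq_or_lt with rfl | ht
    · simp [hH0]
    · exact hHhom ξ hξ t ht
  have hgrad : ∀ x v : EuclideanSpace ℝ (Fin N), ⟪gradient H x, v⟫ = fderiv ℝ H x v := by
    intro x v
    simp [gradient]
  have hC : ∀ x : EuclideanSpace ℝ (Fin N), x ≠ 0 → ContDiffAt ℝ 2 H x := fun x hx =>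
    hHC2.contDiffAt (isOpen_compl_singleton.mem_nhds hx)
  have hD1 : ∀ x : EuclideanSpace ℝ (Fin N), x ≠ 0 → HasFDerivAt H (fderiv ℝ H x) x :=
    fun x hx => ((hC x hx).differentiableAt (by norm_num)).hasFDerivAt
  have heul : ∀ x : EuclideanSpace ℝ (Fin N), x ≠ 0 → fderiv ℝ H x x = H x := by
    intro x hx
    have g : HasDerivAt (fun t : ℝ => t • x) x 1 := by
      simpa using (hasDerivAt_id (1:ℝ)).smul_const x
    have a : HasDerivAt (fun t : ℝ => H (t • x)) (fderiv ℝ H x x) 1 := by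
      have hd : HasFDerivAt H (fderiv ℝ H x) ((1:ℝ) • x) := by
        rw [one_smul]; exact hD1 x hx
      exact hd.comp_hasDerivAt 1 g
    have b : HasDerivAt (fun t : ℝ => H (t • x)) (H x) 1 := by
      have : HasDerivAt (fun t : ℝ => t * H x) (H x) 1 := by
        simpa using (hasDerivAt_id (1:ℝ)).mul_const (H x)
      refine this.congr_of_eventuallyEq ?_
      filter_upwards [lt_mem_nhds (zero_lt_one (α := ℝ))] with t ht using hhom x t ht.le
    exact a.unique b
  obtain ⟨c, hc, hq⟩ := aux_quad hN H hH0 hHC2 hHeven hHpos hhom (by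
    obtain ⟨lam, hl, h⟩ := hHell
    refine ⟨lam, hl, fun ξ hξ ζ hζ => ?_⟩
    have := h ξ hξ ζ (by rw [hgrad]; exact hζ)
    rw [iteratedFDeriv_two_apply] at this
    simpa using this) hC hD1 heul
  have hle : ∀ x y : EuclideanSpace ℝ (Fin N), x ≠ 0 → fderiv ℝ H x y ≤ H y := by
    intro x y hx
    by_cases hy : y = 0
    · simp [hy, hH0]
    have hk := hHpos x hx
    have hh := hHpos y hy
    have := hq x ((H x / H y) • y) hx
    rw [hhom y _ (by positivity), map_smul, smul_eq_mul, div_mul_cancel₀ _ hh.ne'] at this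
    have h0 : 0 ≤ H x ^ 2 + H x ^ 2 - 2 * H x * (H x / H y * fderiv ℝ H x y) :=
      le_trans (by positivity) this
    have e : H x ^ 2 + H x ^ 2 - 2 * H x * (H x / H y * fderiv ℝ H x y)
        = (2 * H x ^ 2 / H y) * (H y - fderiv ℝ H x y) := by
      field_simp; ring
    rw [e] at h0
    linarith [nonneg_of_mul_nonneg_right h0 (by positivity)]
  have htri : ∀ x y : EuclideanSpace ℝ (Fin N), H (y - x) ≤ H y + H x := by
    intro x y
    by_cases hz : y - x = 0
    · rw [hz, hH0]; linarith [hHnonneg x, hHnonneg y]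
    have h1 := hle _ y hz
    have h2 := hle _ (-x) hz
    rw [hHeven] at h2
    rw [← heul _ hz]
    conv_lhs => rw [sub_eq_add_neg (G := EuclideanSpace ℝ (Fin N)) y x]
    rw [← sub_eq_add_neg, map_sub]
    rw [map_neg] at h2
    linarith
  obtain ⟨C, hC0, hC1, hS⟩ := aux_scalar p c hp hc
  refine ⟨C, hC0, fun η η' => ?_⟩
  by_cases h0 : η' = 0
  · subst h0
    have : 0 ≤ H η ^ p := Real.rpow_nonneg (hHnonneg _) _
    simp only [aVec, hH0, if_true, inner_zero_left, sub_zero, mul_zero, add_zero]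
    rw [Real.zero_rpow (by linarith)]
    nlinarith
  · have := hS (H η) (H η') (H (η - η')) (fderiv ℝ H η' η) (hHnonneg _) (hHpos _ h0)
      (hHnonneg _) (htri _ _) (hle _ _ h0) (hq _ _ h0)
    simp only [aVec, if_neg h0]
    rw [real_inner_smul_left, hgrad, map_sub, heul _ h0]
    exact this
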